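/- For all integers 1 ≤ m ≤ n, the number K(n,m) of nonattacking placements of exactly mn kings on the 2m×2n rectangular board satisfies K(n,m) = Σ_{A ⊆ {1,…,n}} Σ_{k=1}^{n+1} m^m_{A,k}. -/

import Mathlib

/-- A placement of kings on an `m × n` board (positions 0-indexed) is nonattacking
if any two distinct positions are at Chebyshev distance at least 2. -/
def Nonattacking {m n : ℕ} (S : Finset (Fin m × Fin n)) : Prop :=
  ∀ p ∈ S, ∀ q ∈ S, p ≠ q →
    2 ≤ max (Nat.dist (p.1 : ℕ) (q.1 : ℕ)) (Nat.dist (p.2 : ℕ) (q.2 : ℕ))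

/-- `p(A,B,k) = max({i ∈ {1,…,n+1} : i < k, i ∉ A, i−1 ∈ B} ∪ {1})`. -/
def pFun (n : ℕ) (A B : Finset ℕ) (k : ℕ) : ℕ :=
  (insert 1 ((Finset.Icc 1 (n + 1)).filter (fun i => i < k ∧ i ∉ A ∧ i - 1 ∈ B))).max'
    (Finset.insert_nonempty _ _)

/-- `q(A,B,k) = min({i ∈ {1,…,n+1} : i > k, i ∈ B, i−1 ∉ A} ∪ {n+1})`. -/
def qFun (n : ℕ) (A B : Finset ℕ) (k : ℕ) : ℕ :=
  (insert (n + 1) ((Finset.Icc 1 (n + 1)).filter (fun i => k < i ∧ i ∈ B ∧ i - 1 ∉ A))).min'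
    (Finset.insert_nonempty _ _)

/-- The matrix entries `m^ℓ_{A,k}`: `m^1_{A,k} = 1` and, for `ℓ > 1`,
`m^ℓ_{A,k} = Σ_{B ⊆ A} Σ_{i = p(A,B,k)}^{q(A,B,k)} m^{ℓ−1}_{B,i}`. -/
def mEnt (n : ℕ) : ℕ → Finset ℕ → ℕ → ℕ
  | 0, _, _ => 0
  | 1, _, _ => 1
  | ℓ + 2, A, k =>
      ∑ B ∈ A.powerset, ∑ i ∈ Finset.Icc (pFun n A B k) (qFun n A B k), mEnt n (ℓ + 1) B i

/-- The admissible states of a row of `2 × 2` blocks: the set of columns whose king is in the upper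
half of its block, and the first column whose king is in the right half of its block. -/
def rowStates (n : ℕ) : Finset (Finset ℕ × ℕ) :=
  (Finset.Icc 1 n).powerset ×ˢ Finset.Icc 1 (n + 1)

/-- A block row in state `t` may stand directly below a block row in state `s`. -/
def RowCompat (n : ℕ) (s t : Finset ℕ × ℕ) : Prop :=
  t.1 ⊆ s.1 ∧ pFun n s.1 t.1 s.2 ≤ t.2 ∧ t.2 ≤ qFun n s.1 t.1 s.2

lemma pFun_le_iff {n : ℕ} {A B : Finset ℕ} {k i : ℕ} (hi : 1 ≤ i) :
    pFun n A B k ≤ i ↔ ∀ j, 1 ≤ j → j ≤ n + 1 → j < k → j ∉ A → j - 1 ∈ B → j ≤ i := by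
  simp only [pFun, Finset.max'_le_iff, Finset.mem_insert, Finset.mem_filter, Finset.mem_Icc]
  grind

lemma le_qFun_iff {n : ℕ} {A B : Finset ℕ} {k i : ℕ} (hi : i ≤ n + 1) :
    i ≤ qFun n A B k ↔ ∀ j, 1 ≤ j → j ≤ n + 1 → k < j → j ∈ B → j - 1 ∉ A → i ≤ j := by
  simp only [qFun, Finset.le_min'_iff, Finset.mem_insert, Finset.mem_filter, Finset.mem_Icc]
  grind

lemma one_le_pFun (n : ℕ) (A B : Finset ℕ) (k : ℕ) : 1 ≤ pFun n A B k :=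
  Finset.le_max' _ _ (Finset.mem_insert_self _ _)

lemma qFun_le (n : ℕ) (A B : Finset ℕ) (k : ℕ) : qFun n A B k ≤ n + 1 :=
  Finset.min'_le _ _ (Finset.mem_insert_self _ _)

open Classical in
/-- The sequences of `ℓ + 1` successively compatible row states. -/
noncomputable def rowPaths (n ℓ : ℕ) : Finset (Fin (ℓ + 1) → Finset ℕ × ℕ) :=
  (Fintype.piFinset fun _ => rowStates n).filter
    fun f => ∀ i : Fin ℓ, RowCompat n (f i.castSucc) (f i.succ)

lemma mem_rowPaths {n ℓ : ℕ} {f : Fin (ℓ + 1) → Finset ℕ × ℕ} :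
    f ∈ rowPaths n ℓ ↔
      (∀ i, f i ∈ rowStates n) ∧ ∀ i : Fin ℓ, RowCompat n (f i.castSucc) (f i.succ) := by
  simp [rowPaths]

lemma cons_mem_rowPaths {n ℓ : ℕ} {s : Finset ℕ × ℕ} {f : Fin (ℓ + 1) → Finset ℕ × ℕ} :
    (Fin.cons s f : Fin (ℓ + 2) → Finset ℕ × ℕ) ∈ rowPaths n (ℓ + 1) ↔
      s ∈ rowStates n ∧ RowCompat n s (f 0) ∧ f ∈ rowPaths n ℓ := by
  simp only [mem_rowPaths, Fin.forall_fin_succ (n := ℓ + 1), Fin.forall_fin_succ (n := ℓ),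
    Fin.cons_zero, Fin.cons_succ, Fin.castSucc_zero, ← Fin.succ_castSucc]
  tauto

open Classical in
lemma card_rowPaths_start_succ {n ℓ : ℕ} {s : Finset ℕ × ℕ} (hs : s ∈ rowStates n) :
    ((rowPaths n (ℓ + 1)).filter fun f => f 0 = s).card =
      ∑ t ∈ (rowStates n).filter (RowCompat n s),
        ((rowPaths n ℓ).filter fun f => f 0 = t).card := by
  rw [← Finset.card_sigma]
  symm
  refine Finset.card_nbij' (fun x => Fin.cons s x.2) (fun f => ⟨f 1, Fin.tail f⟩) ?_ ?_ ?_ ?_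
  · rintro ⟨t, f⟩ h
    simp only [Finset.coe_sigma, Set.mem_sigma_iff, Finset.mem_coe, Finset.mem_filter] at h ⊢
    obtain ⟨⟨-, h⟩, hf, rfl⟩ := h
    exact ⟨cons_mem_rowPaths.2 ⟨hs, h, hf⟩, rfl⟩
  · intro f h
    simp only [Finset.coe_sigma, Set.mem_sigma_iff, Finset.mem_coe, Finset.mem_filter] at h ⊢
    obtain ⟨hf, rfl⟩ := h
    rw [← Fin.cons_self_tail f, cons_mem_rowPaths] at hf
    exact ⟨⟨(mem_rowPaths.1 hf.2.2).1 0, hf.2.1⟩, hf.2.2, rfl⟩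
  · rintro ⟨t, f⟩ h
    simp only [Finset.coe_sigma, Set.mem_sigma_iff, Finset.mem_coe, Finset.mem_filter] at h
    obtain ⟨-, -, rfl⟩ := h
    rfl
  · intro f h
    simp only [Finset.mem_coe, Finset.mem_filter] at h
    obtain ⟨-, rfl⟩ := h
    exact Fin.cons_self_tail f

open Classical in
lemma mEnt_succ_succ_eq_sum {n ℓ : ℕ} {s : Finset ℕ × ℕ} (hs : s ∈ rowStates n) :
    mEnt n (ℓ + 2) s.1 s.2 =
      ∑ t ∈ (rowStates n).filter (RowCompat n s), mEnt n (ℓ + 1) t.1 t.2 := by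
  rw [mEnt, Finset.sum_sigma']
  refine Finset.sum_nbij' (fun x => (x.1, x.2)) (fun t => ⟨t.1, t.2⟩) ?_ ?_ ?_ ?_ ?_
  · rintro ⟨B, i⟩ h
    simp only [rowStates, Finset.mem_product, Finset.mem_sigma, Finset.mem_powerset,
      Finset.mem_Icc, Finset.mem_filter, RowCompat] at *
    exact ⟨⟨h.1.trans hs.1, (one_le_pFun _ _ _ _).trans h.2.1, h.2.2.trans (qFun_le _ _ _ _)⟩, h⟩
  · rintro ⟨B, i⟩ h
    simp only [Finset.mem_sigma, Finset.mem_powerset,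
      Finset.mem_Icc, Finset.mem_filter, RowCompat] at *
    exact h.2
  all_goals intros; rfl

open Classical in
lemma mEnt_eq_card {n ℓ : ℕ} {s : Finset ℕ × ℕ} (hs : s ∈ rowStates n) :
    mEnt n (ℓ + 1) s.1 s.2 = ((rowPaths n ℓ).filter fun f => f 0 = s).card := by
  induction ℓ generalizing s with
  | zero =>
    rw [mEnt, eq_comm, Finset.card_eq_one]
    refine ⟨fun _ => s, Finset.ext fun f => ?_⟩
    simp only [Finset.mem_filter, mem_rowPaths, Finset.mem_singleton]
    constructor
    · rintro ⟨-, h⟩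
      funext i
      rw [show i = 0 from Fin.ext (by omega), h]
    · rintro rfl
      exact ⟨⟨fun _ => hs, fun i => i.elim0⟩, rfl⟩
  | succ ℓ ih =>
    rw [mEnt_succ_succ_eq_sum hs, card_rowPaths_start_succ hs]
    exact Finset.sum_congr rfl fun t ht => ih (Finset.mem_filter.1 ht).1

lemma card_rowPaths (n ℓ : ℕ) :
    (rowPaths n ℓ).card =
      ∑ A ∈ (Finset.Icc 1 n).powerset, ∑ k ∈ Finset.Icc 1 (n + 1), mEnt n (ℓ + 1) A k := by
  classical
  rw [← Finset.sum_product', Finset.card_eq_sum_card_fiberwise (f := fun f => f 0)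
    (t := rowStates n) fun f hf => (mem_rowPaths.1 hf).1 0]
  exact (Finset.sum_congr rfl fun s hs => mEnt_eq_card hs).symm

/-- The position of the king in the block at row `x.1` and column `x.2`, given the row states. -/
def kingPos {m n : ℕ} (f : Fin m → Finset ℕ × ℕ) (x : Fin m × Fin n) :
    Fin (2 * m) × Fin (2 * n) :=
  (⟨2 * x.1 + if (x.2 : ℕ) + 1 ∈ (f x.1).1 then 0 else 1, by split <;> omega⟩,
    ⟨2 * x.2 + if (x.2 : ℕ) + 1 < (f x.1).2 then 0 else 1, by split <;> omega⟩)

lemma kingPos_injective {m n : ℕ} (f : Fin m → Finset ℕ × ℕ) :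
    Function.Injective (kingPos (n := n) f) := by
  rintro ⟨a, b⟩ ⟨c, d⟩ h
  simp only [kingPos, Prod.mk.injEq, Fin.ext_iff] at h ⊢
  grind

/-- The placement of one king in each block that is described by the row states. -/
def kingPlacement {m : ℕ} (n : ℕ) (f : Fin m → Finset ℕ × ℕ) :
    Finset (Fin (2 * m) × Fin (2 * n)) :=
  Finset.univ.image (kingPos f)

lemma card_kingPlacement {m : ℕ} (n : ℕ) (f : Fin m → Finset ℕ × ℕ) :
    (kingPlacement n f).card = m * n := by
  simp [kingPlacement, Finset.card_image_of_injective _ (kingPos_injective f)]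

lemma nonattacking_kingPlacement_iff {m n : ℕ} {f : Fin m → Finset ℕ × ℕ} :
    Nonattacking (kingPlacement n f) ↔ ∀ (a c : Fin m) (b d : Fin n), (a, b) ≠ (c, d) →
      2 ≤ max (Nat.dist (kingPos f (a, b)).1 (kingPos f (c, d)).1)
        (Nat.dist (kingPos f (a, b)).2 (kingPos f (c, d)).2) := by
  simp only [Nonattacking, kingPlacement, Finset.forall_mem_image, Finset.mem_univ, true_imp_iff,
    (kingPos_injective f).ne_iff, Prod.forall]
  exact ⟨fun h a c b d => h a b c d, fun h a b c d => h a c b d⟩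

lemma rowCompat_of_nonattacking {n ℓ : ℕ} {f : Fin (ℓ + 1) → Finset ℕ × ℕ}
    (hf : ∀ i, f i ∈ rowStates n) (h : Nonattacking (kingPlacement n f)) (i : Fin ℓ) :
    RowCompat n (f i.castSucc) (f i.succ) := by
  rw [nonattacking_kingPlacement_iff] at h
  have h' := h i.castSucc i.succ
  have h1 := hf i.castSucc
  have h2 := hf i.succ
  simp only [rowStates, Finset.mem_product, Finset.mem_powerset, Finset.mem_Icc] at h1 h2
  have key : ∀ b d : ℕ, b < n → d < n →
      b + 1 ∉ (f i.castSucc).1 → d + 1 ∈ (f i.succ).1 →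
      2 ≤ Nat.dist (2 * b + if b + 1 < (f i.castSucc).2 then 0 else 1)
        (2 * d + if d + 1 < (f i.succ).2 then 0 else 1) := by
    intro b d hb hd hA hB
    have := h' ⟨b, hb⟩ ⟨d, hd⟩ (by simp [Fin.ext_iff])
    simp only [kingPos, hA, hB, if_true, if_false, Fin.val_castSucc, Fin.val_succ] at this
    rcases le_max_iff.1 this with h | h
    · simp only [Nat.dist] at h
      omega
    · exact h
  refine ⟨fun c hc => ?_, ?_, ?_⟩
  · by_contra hA
    have hc' := Finset.mem_Icc.1 (h2.1 hc)
    obtain ⟨c, rfl⟩ : ∃ d, c = d + 1 := ⟨c - 1, by omega⟩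
    have := key c c (by omega) (by omega) hA hc
    simp only [Nat.dist] at this
    split_ifs at this <;> omega
  · rw [pFun_le_iff h2.2.1]
    intro j hj1 hj2 hjk hA hB
    have hc' := Finset.mem_Icc.1 (h2.1 hB)
    obtain ⟨d, rfl⟩ : ∃ d, j = d + 2 := ⟨j - 2, by omega⟩
    have := key (d + 1) d (by omega) (by omega) hA hB
    simp only [Nat.dist] at this
    split_ifs at this <;> omega
  · rw [le_qFun_iff h2.2.2]
    intro j hj1 hj2 hjk hB hA
    have hc' := Finset.mem_Icc.1 (h2.1 hB)
    obtain ⟨d, rfl⟩ : ∃ d, j = d + 2 := ⟨j - 2, by omega⟩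
    have := key d (d + 1) (by omega) (by omega) hA hB
    simp only [Nat.dist] at this
    split_ifs at this <;> omega

lemma two_le_dist_of_rowCompat {n : ℕ} {s t : Finset ℕ × ℕ} (ht : t ∈ rowStates n)
    (h : RowCompat n s t) {b d : ℕ} (hb : b < n) (hd : d < n)
    (hA : b + 1 ∉ s.1) (hB : d + 1 ∈ t.1) :
    2 ≤ Nat.dist (2 * b + if b + 1 < s.2 then 0 else 1) (2 * d + if d + 1 < t.2 then 0 else 1) := by
  simp only [rowStates, Finset.mem_product, Finset.mem_powerset, Finset.mem_Icc] at ht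
  obtain ⟨h1, h2, h3⟩ := h
  rw [pFun_le_iff ht.2.1] at h2
  rw [le_qFun_iff ht.2.2] at h3
  have hne : b ≠ d := by
    rintro rfl
    exact hA (h1 hB)
  have h2 := h2 (b + 1) (by omega) (by omega)
  have h3 := h3 (d + 1) (by omega) (by omega)
  simp only [Nat.dist]
  rcases Nat.lt_trichotomy b d with hlt | rfl | hlt
  · obtain rfl | hlt : d = b + 1 ∨ b + 1 < d := by omega
    · have := fun hk => h3 hk hB hA
      split_ifs <;> omega
    · split_ifs <;> omega
  · exact absurd rfl hne
  · obtain rfl | hlt : b = d + 1 ∨ d + 1 < b := by omega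
    · have := fun hk => h2 hk hA hB
      split_ifs <;> omega
    · split_ifs <;> omega

lemma two_le_dist_of_rowPath {n ℓ : ℕ} {f : Fin (ℓ + 1) → Finset ℕ × ℕ}
    (hf : f ∈ rowPaths n ℓ) {a c : Fin (ℓ + 1)} {b d : Fin n} (hac : a ≤ c)
    (hne : (a, b) ≠ (c, d)) :
    2 ≤ max (Nat.dist (kingPos f (a, b)).1 (kingPos f (c, d)).1)
      (Nat.dist (kingPos f (a, b)).2 (kingPos f (c, d)).2) := by
  rw [mem_rowPaths] at hf
  rw [le_max_iff]
  rcases hac.eq_or_lt with rfl | hlt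
  · right
    have hbd : (b : ℕ) ≠ d := fun h => hne (by rw [Fin.ext h])
    simp only [kingPos, Nat.dist]
    split_ifs <;> omega
  · by_cases hc : (c : ℕ) = a + 1
    · by_cases hA : (b : ℕ) + 1 ∈ (f a).1
      · left
        simp only [kingPos, Nat.dist, hA, if_true]
        omega
      · by_cases hB : (d : ℕ) + 1 ∈ (f c).1
        · right
          have hR := hf.2 ⟨a, by omega⟩
          have hc' : c = Fin.succ ⟨a, by omega⟩ := Fin.ext hc
          refine two_le_dist_of_rowCompat (hf.1 c) ?_ b.2 d.2 hA hB
          rw [hc']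
          exact hR
        · left
          simp only [kingPos, Nat.dist, hA, hB, if_false]
          omega
    · left
      have : (a : ℕ) < c := hlt
      simp only [kingPos, Nat.dist]
      split_ifs <;> omega

lemma nonattacking_of_mem_rowPaths {n ℓ : ℕ} {f : Fin (ℓ + 1) → Finset ℕ × ℕ}
    (hf : f ∈ rowPaths n ℓ) : Nonattacking (kingPlacement n f) := by
  rw [nonattacking_kingPlacement_iff]
  intro a c b d hne
  rcases le_total a c with hac | hac
  · exact two_le_dist_of_rowPath hf hac hne
  · rw [Nat.dist_comm, Nat.dist_comm (kingPos f (a, b)).2]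
    exact two_le_dist_of_rowPath hf hac hne.symm

lemma kingPlacement_injOn (n m : ℕ) :
    Set.InjOn (kingPlacement (m := m) n) {f | ∀ i, f i ∈ rowStates n} := by
  intro f hf g hg h
  have key : ∀ x, kingPos (n := n) f x = kingPos g x := by
    intro x
    have hx : kingPos f x ∈ kingPlacement n g := by
      rw [← h]
      exact Finset.mem_image_of_mem _ (Finset.mem_univ x)
    obtain ⟨y, -, hy⟩ := Finset.mem_image.1 hx
    obtain ⟨a, b⟩ := x
    obtain ⟨c, d⟩ := y
    obtain ⟨rfl, rfl⟩ : c = a ∧ d = b := by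
      simp only [kingPos, Prod.mk.injEq, Fin.mk.injEq] at hy
      simp only [Fin.ext_iff]
      grind
    exact hy.symm
  funext i
  have h1 := hf i
  have h2 := hg i
  simp only [rowStates, Finset.mem_product, Finset.mem_powerset, Finset.mem_Icc] at h1 h2
  have key' : ∀ c, c < n → ((c + 1 ∈ (f i).1 ↔ c + 1 ∈ (g i).1) ∧
      (c + 1 < (f i).2 ↔ c + 1 < (g i).2)) := by
    intro c hc
    have := key (i, ⟨c, hc⟩)
    simp only [kingPos, Prod.mk.injEq, Fin.mk.injEq] at this
    grind
  refine Prod.ext (Finset.ext fun c => ?_) ?_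
  · by_cases hc : 1 ≤ c ∧ c ≤ n
    · have := (key' (c - 1) (by omega)).1
      rwa [Nat.sub_add_cancel hc.1] at this
    · exact iff_of_false (fun h => hc (Finset.mem_Icc.1 (h1.1 h)))
        fun h => hc (Finset.mem_Icc.1 (h2.1 h))
  · rcases Nat.lt_trichotomy (f i).2 (g i).2 with hlt | heq | hlt
    · have := (key' ((f i).2 - 1) (by omega)).2
      omega
    · exact heq
    · have := (key' ((g i).2 - 1) (by omega)).2
      omega

/-- A predicate on an initial segment of `ℕ` closed under predecessor is given by a threshold. -/
lemma exists_threshold (n : ℕ) (P : ℕ → Prop) (h : ∀ c, c + 1 < n → P (c + 1) → P c) :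
    ∃ k, 1 ≤ k ∧ k ≤ n + 1 ∧ ∀ c < n, (P c ↔ c + 1 < k) := by
  induction n with
  | zero => exact ⟨1, by omega, by omega, by omega⟩
  | succ n ih =>
    obtain ⟨k, hk1, hk2, hk⟩ := ih fun c hc => h c (by omega)
    by_cases hP : P n
    · have hkn : k = n + 1 := by
        rcases n with _ | n
        · omega
        · have := (hk n (by omega)).1 (h n (by omega) hP)
          omega
      refine ⟨n + 2, by omega, by omega, fun c hc => ?_⟩
      rcases Nat.lt_succ_iff_lt_or_eq.1 hc with hc | rfl
      · have := hk c hc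
        grind
      · grind
    · refine ⟨k, hk1, by omega, fun c hc => ?_⟩
      rcases Nat.lt_succ_iff_lt_or_eq.1 hc with hc | rfl
      · exact hk c hc
      · grind

lemma exists_mem_block {m n : ℕ} {S : Finset (Fin (2 * m) × Fin (2 * n))}
    (hS : Nonattacking S) (hcard : S.card = m * n) (x : Fin m × Fin n) :
    ∃ p ∈ S, (p.1 : ℕ) / 2 = x.1 ∧ (p.2 : ℕ) / 2 = x.2 := by
  let blk : Fin (2 * m) × Fin (2 * n) → Fin m × Fin n := fun p =>
    (⟨p.1 / 2, by omega⟩, ⟨p.2 / 2, by omega⟩)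
  have hinj : Set.InjOn blk S := by
    intro p hp q hq h
    by_contra hne
    have := hS p hp q hq hne
    simp only [blk, Prod.mk.injEq, Fin.mk.injEq] at h
    simp only [Nat.dist] at this
    omega
  have himg : S.image blk = Finset.univ := by
    rw [← Finset.card_eq_iff_eq_univ, Finset.card_image_of_injOn hinj, hcard]
    simp
  obtain ⟨p, hp, rfl⟩ := Finset.mem_image.1 (himg ▸ Finset.mem_univ x)
  exact ⟨p, hp, rfl, rfl⟩

lemma exists_eq_kingPlacement {m n : ℕ} {S : Finset (Fin (2 * m) × Fin (2 * n))}
    (hS : Nonattacking S) (hcard : S.card = m * n) :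
    ∃ f : Fin m → Finset ℕ × ℕ, (∀ i, f i ∈ rowStates n) ∧ kingPlacement n f = S := by
  classical
  choose g hgS hg1 hg2 using exists_mem_block hS hcard
  have hk : ∀ a : Fin m, ∃ k, 1 ≤ k ∧ k ≤ n + 1 ∧ ∀ c < n,
      ((∃ hc : c < n, ((g (a, ⟨c, hc⟩)).2 : ℕ) = 2 * c) ↔ c + 1 < k) := by
    intro a
    refine exists_threshold n _ ?_
    rintro c - ⟨hc, hP⟩
    refine ⟨by omega, ?_⟩
    by_contra hne
    have h1 := hg1 (a, ⟨c, by omega⟩)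
    have h2 := hg2 (a, ⟨c, by omega⟩)
    have h3 := hg1 (a, ⟨c + 1, hc⟩)
    have := hS _ (hgS (a, ⟨c, by omega⟩)) _ (hgS (a, ⟨c + 1, hc⟩)) (by
      intro h
      rw [h, hP] at h2
      simp only at h2
      omega)
    simp only [Nat.dist] at *
    omega
  choose k hk1 hk2 hk using hk
  let A : Fin m → Finset ℕ := fun a => (Finset.Icc 1 n).filter fun c =>
    ∃ hc : c - 1 < n, ((g (a, ⟨c - 1, hc⟩)).1 : ℕ) = 2 * a
  refine ⟨fun a => (A a, k a), fun a => ?_, ?_⟩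
  · simp only [rowStates, Finset.mem_product, Finset.mem_powerset, Finset.mem_Icc]
    exact ⟨Finset.filter_subset _ _, hk1 a, hk2 a⟩
  · refine Finset.eq_of_subset_of_card_le ?_ (by rw [card_kingPlacement, hcard])
    rintro p hp
    obtain ⟨⟨a, b⟩, -, rfl⟩ := Finset.mem_image.1 hp
    convert hgS (a, b) using 1
    have h1 : ((g (a, b)).1 : ℕ) / 2 = a := hg1 (a, b)
    have h2 : ((g (a, b)).2 : ℕ) / 2 = b := hg2 (a, b)
    have h3 := hk a b b.2
    have h4 : (b : ℕ) + 1 ∈ A a ↔ ((g (a, b)).1 : ℕ) = 2 * a := by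
      simp [A]
    simp only [Fin.is_lt, Fin.eta, exists_true_left] at h3
    refine Prod.ext (Fin.ext ?_) (Fin.ext ?_)
    · simp only [kingPos, h4]
      split_ifs <;> omega
    · simp only [kingPos, ← h3]
      split_ifs <;> omega

/-- The number of nonattacking placements of `mn` kings on the `2m × 2n` board
(`1 ≤ m ≤ n`) equals `Σ_{A ⊆ {1,…,n}} Σ_{k=1}^{n+1} m^m_{A,k}`. -/
theorem count_kings_rectangle (n m : ℕ) (hm : 1 ≤ m) (hmn : m ≤ n) :
    Set.ncard {S : Finset (Fin (2 * m) × Fin (2 * n)) |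
        Nonattacking S ∧ S.card = m * n} =
      ∑ A ∈ (Finset.Icc 1 n).powerset, ∑ k ∈ Finset.Icc 1 (n + 1), mEnt n m A k := by
  obtain ⟨ℓ, rfl⟩ : ∃ ℓ, m = ℓ + 1 := ⟨m - 1, by omega⟩
  rw [← card_rowPaths, ← Set.ncard_coe_finset]
  symm
  refine Set.ncard_congr (fun f _ => kingPlacement n f) ?_ ?_ ?_
  · intro f hf
    exact ⟨nonattacking_of_mem_rowPaths hf, card_kingPlacement n f⟩
  · intro f g hf hg h
    exact kingPlacement_injOn n _ (mem_rowPaths.1 hf).1 (mem_rowPaths.1 hg).1 h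
  · rintro S ⟨hS, hcard⟩
    obtain ⟨f, hf, rfl⟩ := exists_eq_kingPlacement hS hcard
    exact ⟨f, mem_rowPaths.2 ⟨hf, rowCompat_of_nonattacking hf hS⟩, rfl⟩
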